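/- Let S = T² × ℝ₊ with measure μ = μ_L × μ_W, where μ_L is Lebesgue measure on T² and μ_W is the law of a nonnegative random variable W with E[W²] < ∞. Define the integral operator (T_κ f)(u,x) = ∫_S c·κ₁(u,v)·x·y·f(v,y) dμ(v,y) on nonnegative measurable functions f on S. Then the operator norm ‖T_κ‖ := sup{ ‖T_κ f‖_{L²(μ)} : f ≥ 0, ‖f‖_{L²(μ)} ≤ 1 } equals λ·E[W²], where λ = 4c·log 2. -/

import Mathlib

open MeasureTheory

/-- The kernel `κ((u,x),(v,y)) = κ₁(u,v) x y` on `S = T² × ℝ₊`, where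
`κ₁(u,v) = 1/ρ(u,v)` and `ρ(u,v) = ‖u₁ - v₁‖ + ‖u₂ - v₂‖` is the torus distance on
`T² = (ℝ/ℤ)²`. The integral operator `T_κ` (with the factor `c`) is
`(T_κ f)(u,x) = ∫_S c κ₁(u,v) x y f(v,y) dμ(v,y)`. -/
noncomputable def Tkappa (c : ℝ) (μW : Measure ℝ)
    (f : (AddCircle (1 : ℝ) × AddCircle (1 : ℝ)) × ℝ → ℝ) :
    (AddCircle (1 : ℝ) × AddCircle (1 : ℝ)) × ℝ → ℝ := fun p =>
  ∫ q, c * (1 / (‖p.1.1 - q.1.1‖ + ‖p.1.2 - q.1.2‖)) * p.2 * q.2 * f q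
    ∂((volume : Measure (AddCircle (1 : ℝ) × AddCircle (1 : ℝ))).prod μW)

open scoped ENNReal

instance isAddLeftInvariant_volume_torus :
    (volume : Measure (AddCircle (1 : ℝ) × AddCircle (1 : ℝ))).IsAddLeftInvariant := by
  rw [Measure.volume_eq_prod]; infer_instance

instance isNegInvariant_volume_torus :
    (volume : Measure (AddCircle (1 : ℝ) × AddCircle (1 : ℝ))).IsNegInvariant :=
  ⟨((Measure.measurePreserving_neg (volume : Measure (AddCircle (1 : ℝ)))).prod
    (Measure.measurePreserving_neg (volume : Measure (AddCircle (1 : ℝ))))).map_eq⟩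

instance isProbabilityMeasure_volume_torus :
    IsProbabilityMeasure (volume : Measure (AddCircle (1 : ℝ) × AddCircle (1 : ℝ))) := by
  have : IsProbabilityMeasure (volume : Measure (AddCircle (1 : ℝ))) :=
    ⟨by simp [AddCircle.measure_univ]⟩
  rw [Measure.volume_eq_prod]; infer_instance

/-- The lower integral over the unit circle of a function of the norm. -/
lemma lintegral_comp_norm_addCircle (g : ℝ → ℝ≥0∞) :
    ∫⁻ b : AddCircle (1 : ℝ), g ‖b‖ = 2 * ∫⁻ t in Set.Ioc (0 : ℝ) (1 / 2), g t := by
  rw [← AddCircle.lintegral_preimage (1 : ℝ) (-(1 / 2)) (fun b => g ‖b‖)]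
  have h1 : ∫⁻ a in Set.Ioc (-(1 / 2) : ℝ) (-(1 / 2) + 1), g ‖(a : AddCircle (1 : ℝ))‖
      = ∫⁻ a in Set.Ioc (-(1 / 2) : ℝ) (1 / 2), g |a| := by
    rw [show (-(1 / 2) + 1 : ℝ) = 1 / 2 by norm_num]
    refine setLIntegral_congr_fun measurableSet_Ioc fun a ha => ?_
    have : ‖(a : AddCircle (1 : ℝ))‖ = |a| :=
      (AddCircle.norm_coe_eq_abs_iff 1 one_ne_zero).2 (by
        rw [abs_one]; exact abs_le.2 ⟨ha.1.le, ha.2⟩)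
    simp only [this]
  have h2 : ∫⁻ a in Set.Ioc (0 : ℝ) (1 / 2), g |a| = ∫⁻ a in Set.Ioc (0 : ℝ) (1 / 2), g a :=
    setLIntegral_congr_fun measurableSet_Ioc fun a ha => by simp only [abs_of_pos ha.1]
  have h3 : ∫⁻ a in Set.Ioc (-(1 / 2) : ℝ) 0, g |a| = ∫⁻ a in Set.Ioc (0 : ℝ) (1 / 2), g |a| := by
    rw [setLIntegral_congr (Ioc_ae_eq_Icc (a := (0 : ℝ))), setLIntegral_congr Ioc_ae_eq_Icc,
      ← (Measure.measurePreserving_neg (volume : Measure ℝ)).setLIntegral_comp_preimage_emb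
        (MeasurableEquiv.neg ℝ).measurableEmbedding]
    simp
  rw [h1, ← Set.Ioc_union_Ioc_eq_Ioc (b := 0) (by norm_num) (by norm_num),
    lintegral_union measurableSet_Ioc (Set.Ioc_disjoint_Ioc_of_le le_rfl), h3, h2, two_mul]

lemma lintegral_Ioc_inv_add {s : ℝ} (hs : 0 < s) :
    ∫⁻ t in Set.Ioc (0 : ℝ) (1 / 2), ENNReal.ofReal (1 / (s + t))
      = ENNReal.ofReal (Real.log (s + 1 / 2) - Real.log s) := by
  have hint : IntervalIntegrable (fun t : ℝ => 1 / (s + t)) volume 0 (1 / 2) := by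
    refine ContinuousOn.intervalIntegrable_of_Icc (by norm_num) ?_
    refine continuousOn_const.div (by fun_prop) fun t ht => ?_
    have := ht.1
    positivity
  rw [← ofReal_integral_eq_lintegral_ofReal hint.1, ← intervalIntegral.integral_of_le (by norm_num)]
  · congr 1
    simp only [one_div]
    rw [intervalIntegral.integral_comp_add_left (fun x => x⁻¹), integral_inv_of_pos (by simpa)
      (by positivity), Real.log_div (by positivity) (by simpa using hs.ne')]
    simp
  · filter_upwards [ae_restrict_mem measurableSet_Ioc] with t ht
    have := ht.1
    simp only [Pi.zero_apply]
    positivity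

lemma lintegral_Ioc_log_sub_log :
    ∫⁻ s in Set.Ioc (0 : ℝ) (1 / 2), ENNReal.ofReal (Real.log (s + 1 / 2) - Real.log s)
      = ENNReal.ofReal (Real.log 2) := by
  have i1 : IntervalIntegrable (fun s : ℝ => Real.log (s + 1 / 2)) volume 0 (1 / 2) := by
    refine ContinuousOn.intervalIntegrable_of_Icc (by norm_num) ?_
    refine ContinuousOn.log (by fun_prop) fun t ht => ?_
    have := ht.1
    positivity
  have i2 : IntervalIntegrable Real.log volume 0 (1 / 2) :=
    intervalIntegral.intervalIntegrable_log'
  rw [← ofReal_integral_eq_lintegral_ofReal (i1.sub i2).1,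
    ← intervalIntegral.integral_of_le (by norm_num)]
  · rw [intervalIntegral.integral_sub i1 i2,
      intervalIntegral.integral_comp_add_right (fun x => Real.log x), integral_log, integral_log]
    congr 1
    have hhalf : Real.log (1 / 2) = -Real.log 2 := by rw [one_div, Real.log_inv]
    norm_num [hhalf]
    ring
  · filter_upwards [ae_restrict_mem measurableSet_Ioc] with t ht
    have := ht.1
    simp only [Pi.zero_apply, sub_nonneg]
    exact Real.log_le_log this (by linarith)

/-- The total mass of the kernel `1 / ρ` on the torus is `4 log 2`. -/
lemma lintegral_torus_kernel :
    ∫⁻ v : AddCircle (1 : ℝ) × AddCircle (1 : ℝ), ENNReal.ofReal (1 / (‖v.1‖ + ‖v.2‖))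
      = ENNReal.ofReal (4 * Real.log 2) := by
  rw [Measure.volume_eq_prod, lintegral_prod _ (by fun_prop)]
  rw [lintegral_congr fun x : AddCircle (1 : ℝ) =>
      lintegral_comp_norm_addCircle fun t => ENNReal.ofReal (1 / (‖x‖ + t)),
    lintegral_comp_norm_addCircle
    (fun s => 2 * ∫⁻ t in Set.Ioc (0 : ℝ) (1 / 2), ENNReal.ofReal (1 / (s + t))),
    setLIntegral_congr_fun (g := fun s =>
      2 * ENNReal.ofReal (Real.log (s + 1 / 2) - Real.log s)) measurableSet_Ioc
      (fun s hs => by simp only [lintegral_Ioc_inv_add hs.1]),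
    lintegral_const_mul _ (by fun_prop), lintegral_Ioc_log_sub_log, ← mul_assoc,
    ENNReal.ofReal_mul (by norm_num)]
  norm_num

lemma integral_torus_kernel (u : AddCircle (1 : ℝ) × AddCircle (1 : ℝ)) :
    ∫ v : AddCircle (1 : ℝ) × AddCircle (1 : ℝ), 1 / (‖u.1 - v.1‖ + ‖u.2 - v.2‖)
      = 4 * Real.log 2 := by
  refine (integral_sub_left_eq_self
    (fun v : AddCircle (1 : ℝ) × AddCircle (1 : ℝ) => 1 / (‖v.1‖ + ‖v.2‖)) volume u).trans ?_
  rw [integral_eq_lintegral_of_nonneg_ae (.of_forall fun v => by positivity)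
      (Measurable.aestronglyMeasurable (by fun_prop)), lintegral_torus_kernel, ENNReal.toReal_ofReal]
  have := Real.log_nonneg one_le_two
  positivity

lemma eLpNorm_two_sq {α : Type*} [MeasurableSpace α] {μ : Measure α} (f : α → ℝ) :
    eLpNorm f 2 μ ^ 2 = ∫⁻ a, ‖f a‖ₑ ^ 2 ∂μ := by
  simpa using eLpNorm_nnreal_pow_eq_lintegral (μ := μ) (f := f) (p := 2) two_ne_zero

/-- The Cauchy–Schwarz inequality with a nonnegative weight. -/
lemma sq_lintegral_mul_le {α : Type*} [MeasurableSpace α] {μ : Measure α} {w f g : α → ℝ≥0∞}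
    (hw : Measurable w) (hf : Measurable f) (hg : Measurable g) :
    (∫⁻ a, w a * f a * g a ∂μ) ^ 2 ≤
      (∫⁻ a, w a * f a ^ 2 ∂μ) * ∫⁻ a, w a * g a ^ 2 ∂μ := by
  have hsq : ∀ x : ℝ≥0∞, (x ^ (1 / 2 : ℝ)) ^ 2 = x := fun x => by
    rw [← ENNReal.rpow_natCast, ← ENNReal.rpow_mul]; norm_num
  have h := ENNReal.lintegral_mul_le_Lp_mul_Lq μ Real.HolderConjugate.two_two
    (f := fun a => w a ^ (1 / 2 : ℝ) * f a) (g := fun a => w a ^ (1 / 2 : ℝ) * g a)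
    (by fun_prop) (by fun_prop)
  have e : ∀ a, w a ^ (1 / 2 : ℝ) * f a * (w a ^ (1 / 2 : ℝ) * g a) = w a * f a * g a := fun a => by
    conv_rhs => rw [← hsq (w a)]
    ring
  simp only [Pi.mul_apply, e, ENNReal.rpow_two, mul_pow, hsq] at h
  calc _ ≤ _ := pow_le_pow_left' h 2
    _ = _ := by rw [mul_pow, hsq, hsq]

/-- The Schur test for the product of a convolution kernel and a rank-one kernel. -/
lemma lintegral_sq_convolution_rankOne_le {G β : Type*} [MeasurableSpace G] [AddCommGroup G]
    [MeasurableAdd₂ G] [MeasurableNeg G] [MeasurableSpace β]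
    {μ : Measure G} [SFinite μ] [μ.IsAddLeftInvariant] [μ.IsNegInvariant]
    {ν : Measure β} [SFinite ν] {k : G → ℝ≥0∞} {φ : β → ℝ≥0∞} {g : G × β → ℝ≥0∞}
    (hk : Measurable k) (hφ : Measurable φ) (hg : Measurable g) :
    ∫⁻ p, (φ p.2 * ∫⁻ q, k (p.1 - q.1) * φ q.2 * g q ∂μ.prod ν) ^ 2 ∂μ.prod ν ≤
      ((∫⁻ v, k v ∂μ) * ∫⁻ y, φ y ^ 2 ∂ν) ^ 2 * ∫⁻ q, g q ^ 2 ∂μ.prod ν := by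
  set A := ∫⁻ v, k v ∂μ
  set B := ∫⁻ y, φ y ^ 2 ∂ν
  have hA : ∀ u, ∫⁻ v, k (u - v) ∂μ = A := fun u => lintegral_sub_left_eq_self k u
  have hA' : ∀ v, ∫⁻ u, k (u - v) ∂μ = A := fun v => by
    simpa only [sub_eq_add_neg] using lintegral_add_right_eq_self (μ := μ) k (-v)
  have hpt : ∀ p : G × β, (φ p.2 * ∫⁻ q, k (p.1 - q.1) * φ q.2 * g q ∂μ.prod ν) ^ 2 ≤
      (A * B * ∫⁻ q, k (p.1 - q.1) * g q ^ 2 ∂μ.prod ν) * φ p.2 ^ 2 := fun p => by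
    have h := sq_lintegral_mul_le (μ := μ.prod ν) (w := fun q => k (p.1 - q.1))
      (f := fun q => φ q.2) (g := g) (by fun_prop) (by fun_prop) hg
    rw [lintegral_prod_mul (f := fun v => k (p.1 - v)) (g := fun y => φ y ^ 2)
      (by fun_prop) (by fun_prop), hA] at h
    rw [mul_pow, mul_comm]
    gcongr
  have hkg : Measurable fun z : G × (G × β) => k (z.1 - z.2.1) * g z.2 ^ 2 := by fun_prop
  have hI : Measurable fun u => ∫⁻ q, k (u - q.1) * g q ^ 2 ∂μ.prod ν := hkg.lintegral_prod_right'
  calc _ ≤ ∫⁻ p, (A * B * ∫⁻ q, k (p.1 - q.1) * g q ^ 2 ∂μ.prod ν) * φ p.2 ^ 2 ∂μ.prod ν :=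
        lintegral_mono hpt
    _ = A * B * (∫⁻ u, ∫⁻ q, k (u - q.1) * g q ^ 2 ∂μ.prod ν ∂μ) * B := by
        rw [lintegral_prod_mul (f := fun u => A * B * ∫⁻ q, k (u - q.1) * g q ^ 2 ∂μ.prod ν)
          (g := fun y => φ y ^ 2) (by fun_prop) (by fun_prop), lintegral_const_mul _ hI]
    _ = A * B * (∫⁻ q, A * g q ^ 2 ∂μ.prod ν) * B := by
        rw [lintegral_lintegral_swap hkg.aemeasurable]
        congr 3
        funext q
        rw [lintegral_mul_const _ (by fun_prop), hA']
    _ = _ := by rw [lintegral_const_mul _ (by fun_prop)]; ring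

lemma eLpNorm_Tkappa_le {c : ℝ} (hc : 0 ≤ c) (μW : Measure ℝ) [IsProbabilityMeasure μW]
    (hW2 : Integrable (fun x => x ^ 2) μW)
    {f : (AddCircle (1 : ℝ) × AddCircle (1 : ℝ)) × ℝ → ℝ} (hf : Measurable f) :
    eLpNorm (Tkappa c μW f) 2 ((volume : Measure (AddCircle (1 : ℝ) × AddCircle (1 : ℝ))).prod μW)
      ≤ ENNReal.ofReal ((4 * c * Real.log 2) * ∫ x, x ^ 2 ∂μW) * eLpNorm f 2
        ((volume : Measure (AddCircle (1 : ℝ) × AddCircle (1 : ℝ))).prod μW) := by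
  have hk : Measurable fun v : AddCircle (1 : ℝ) × AddCircle (1 : ℝ) =>
      ENNReal.ofReal (1 / (‖v.1‖ + ‖v.2‖)) := by fun_prop
  have hB : ∫⁻ y, ‖y‖ₑ ^ 2 ∂μW = ENNReal.ofReal (∫ x, x ^ 2 ∂μW) := by
    rw [ofReal_integral_eq_lintegral_ofReal hW2 (.of_forall fun x => sq_nonneg x)]
    refine lintegral_congr fun y => ?_
    rw [Real.enorm_eq_ofReal_abs, ← ENNReal.ofReal_pow (abs_nonneg y), sq_abs]
  have h := lintegral_sq_convolution_rankOne_le (ν := μW)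
    (μ := (volume : Measure (AddCircle (1 : ℝ) × AddCircle (1 : ℝ)))) hk
    (φ := fun y : ℝ => ‖y‖ₑ) measurable_enorm hf.enorm
  rw [lintegral_torus_kernel, hB, ← eLpNorm_two_sq] at h
  have hle : ∀ p, ‖Tkappa c μW f p‖ₑ ≤ ENNReal.ofReal c * (‖p.2‖ₑ *
      ∫⁻ q, ENNReal.ofReal (1 / (‖(p.1 - q.1).1‖ + ‖(p.1 - q.1).2‖)) * ‖q.2‖ₑ * ‖f q‖ₑ
        ∂((volume : Measure (AddCircle (1 : ℝ) × AddCircle (1 : ℝ))).prod μW)) := fun p => by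
    refine (enorm_integral_le_lintegral_enorm _).trans_eq ?_
    rw [← lintegral_const_mul _ (by fun_prop), ← lintegral_const_mul _ (by fun_prop)]
    refine lintegral_congr fun q => ?_
    rw [enorm_mul, enorm_mul, enorm_mul, enorm_mul, Real.enorm_of_nonneg hc,
      Real.enorm_of_nonneg (by positivity)]
    simp only [Prod.fst_sub, Prod.snd_sub]
    ring
  rw [← ENNReal.pow_le_pow_left_iff two_ne_zero, eLpNorm_two_sq]
  calc _ ≤ _ := lintegral_mono fun p => pow_le_pow_left' (hle p) 2
    _ = _ := by simp only [mul_pow (ENNReal.ofReal c)]; exact lintegral_const_mul' _ _ (by finiteness)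
    _ ≤ _ := mul_le_mul_right h _
    _ = _ := by
      have := Real.log_nonneg one_le_two
      rw [show 4 * c * Real.log 2 = c * (4 * Real.log 2) by ring, mul_assoc c,
        ENNReal.ofReal_mul hc,
        ENNReal.ofReal_mul (p := 4 * Real.log 2) (by positivity)]
      ring

/-- `T_κ` acts on functions of the weight alone by `h ↦ (4 c log 2) ⟨y, h⟩ x`. -/
lemma Tkappa_comp_snd (c : ℝ) (μW : Measure ℝ) [IsProbabilityMeasure μW] (h : ℝ → ℝ) :
    Tkappa c μW (fun q => h q.2) =
      fun p => (4 * c * Real.log 2) * (∫ y, y * h y ∂μW) * p.2 := by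
  funext p
  calc _ = ∫ q, (c * p.2 * (1 / (‖p.1.1 - q.1.1‖ + ‖p.1.2 - q.1.2‖))) * (q.2 * h q.2)
        ∂((volume : Measure (AddCircle (1 : ℝ) × AddCircle (1 : ℝ))).prod μW) :=
      integral_congr_ae (.of_forall fun q => by ring)
    _ = _ := by
      rw [integral_prod_mul (fun v : AddCircle (1 : ℝ) × AddCircle (1 : ℝ) =>
        c * p.2 * (1 / (‖p.1.1 - v.1‖ + ‖p.1.2 - v.2‖))) (fun y => y * h y),
        integral_const_mul, integral_torus_kernel]
      ring

lemma eLpNorm_two_comp_snd {α : Type*} [MeasurableSpace α] (μ : Measure α)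
    [IsProbabilityMeasure μ] {μW : Measure ℝ} [SFinite μW] {h : ℝ → ℝ} (hh : Measurable h)
    (hint : Integrable (fun y => h y ^ 2) μW) :
    eLpNorm (fun q : α × ℝ => h q.2) 2 (μ.prod μW) ^ 2 = ENNReal.ofReal (∫ y, h y ^ 2 ∂μW) := by
  rw [eLpNorm_two_sq, ofReal_integral_eq_lintegral_ofReal hint (.of_forall fun x => sq_nonneg _)]
  have := lintegral_prod_mul (μ := μ) (ν := μW) (f := fun _ => 1) (g := fun y => ‖h y‖ₑ ^ 2)
    (by fun_prop) (by fun_prop)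
  simp only [one_mul, lintegral_one, measure_univ] at this
  rw [this]
  refine lintegral_congr fun y => ?_
  rw [Real.enorm_eq_ofReal_abs, ← ENNReal.ofReal_pow (abs_nonneg _), sq_abs]

/-- On `S = T² × ℝ₊` with `μ = μ_L × μ_W`, where `μ_W` is the law of a
nonnegative random variable `W` with `E W² < ∞`, the norm
`‖T_κ‖ = sup{‖T_κ f‖₂ : f ≥ 0 measurable, ‖f‖₂ ≤ 1}` of the integral operator equals
`λ E W²` with `λ = 4 c log 2`. -/
theorem operator_norm_eq
    (c : ℝ) (hc : 0 < c)
    (μW : Measure ℝ) [IsProbabilityMeasure μW]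
    (hWnonneg : μW (Set.Iio 0) = 0)
    (hW2 : Integrable (fun x => x ^ 2) μW) :
    (⨆ (f : (AddCircle (1 : ℝ) × AddCircle (1 : ℝ)) × ℝ → ℝ) (_ : Measurable f)
        (_ : ∀ q, 0 ≤ f q)
        (_ : eLpNorm f 2
          (((volume : Measure (AddCircle (1 : ℝ) × AddCircle (1 : ℝ)))).prod μW) ≤ 1),
        eLpNorm (Tkappa c μW f) 2
          (((volume : Measure (AddCircle (1 : ℝ) × AddCircle (1 : ℝ)))).prod μW)) =
      ENNReal.ofReal ((4 * c * Real.log 2) * ∫ x, x ^ 2 ∂μW) := by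
  set E := ∫ x, x ^ 2 ∂μW with hE
  have hlog := Real.log_nonneg one_le_two
  have hE0 : 0 ≤ E := integral_nonneg fun x => sq_nonneg x
  apply le_antisymm
  · refine iSup_le fun f => iSup_le fun hf => iSup_le fun _ => iSup_le fun hf1 => ?_
    exact (eLpNorm_Tkappa_le hc.le μW hW2 hf).trans (mul_le_of_le_one_right' hf1)
  rcases hE0.eq_or_lt with h0 | hpos
  · simp [← h0]
  have hpos_ae : ∀ᵐ y ∂μW, max y 0 = y := by
    have : ∀ᵐ y ∂μW, y ∉ Set.Iio (0 : ℝ) := measure_eq_zero_iff_ae_notMem.1 hWnonneg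
    filter_upwards [this] with y hy using max_eq_left (not_lt.1 fun h => hy h)
  set s := (√E)⁻¹ with hs
  have hs2 : s ^ 2 * E = 1 := by
    rw [hs, inv_pow, Real.sq_sqrt hE0, inv_mul_cancel₀ hpos.ne']
  have hae : (fun y => (s * max y 0) ^ 2) =ᵐ[μW] fun y => s ^ 2 * y ^ 2 := by
    filter_upwards [hpos_ae] with y hy
    rw [hy, mul_pow]
  have hnorm : eLpNorm (fun q : (AddCircle (1 : ℝ) × AddCircle (1 : ℝ)) × ℝ => s * max q.2 0) 2
      ((volume : Measure (AddCircle (1 : ℝ) × AddCircle (1 : ℝ))).prod μW) ≤ 1 := by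
    rw [← ENNReal.pow_le_pow_left_iff two_ne_zero, eLpNorm_two_comp_snd _ (by fun_prop)
      ((hW2.const_mul (s ^ 2)).congr hae.symm), integral_congr_ae hae, integral_const_mul, hs2]
    simp
  refine le_iSup₂_of_le (fun q => s * max q.2 0) (by fun_prop) <|
    le_iSup₂_of_le (fun q => by positivity) hnorm ?_
  have hsE : ∫ y, y * (s * max y 0) ∂μW = s * E := by
    rw [hE, ← integral_const_mul]
    refine integral_congr_ae ?_
    filter_upwards [hpos_ae] with y hy
    rw [hy]; ring
  rw [Tkappa_comp_snd c μW fun y => s * max y 0, hsE, ← ENNReal.pow_le_pow_left_iff two_ne_zero,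
    eLpNorm_two_comp_snd (h := fun y => 4 * c * Real.log 2 * (s * E) * y) _ (by fun_prop)
      (by
        simp only [mul_pow _ (_ : ℝ) 2]
        exact hW2.const_mul _),
    ← ENNReal.ofReal_pow (by positivity)]
  simp only [mul_pow _ (_ : ℝ) 2, integral_const_mul, ← hE]
  refine ENNReal.ofReal_le_ofReal (le_of_eq ?_)
  linear_combination -(4 * c * Real.log 2) ^ 2 * E ^ 2 * hs2
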